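/- arXiv:1411.6985 — 2 statements merged into one kernel-verified Lean document; each statement's English description precedes it below -/
import Mathlib

section
/- Let k be a field and let R1 and R2 be nonzero commutative noetherian k-algebras. Let C1 be a finitely generated R1-module and C2 a finitely generated R2-module. Then C1 ⊗_k C2 is a semidualizing module over R1 ⊗_k R2 if and only if C1 is a semidualizing R1-module and C2 is a semidualizing R2-module. -/
open TensorProduct CategoryTheory

section TensorModule

variable (k : Type) [CommRing k] (R1 R2 : Type) [CommRing R1] [CommRing R2]
  [Algebra k R1] [Algebra k R2]
variable (M1 M2 : Type) [AddCommGroup M1] [Module k M1] [Module R1 M1] [IsScalarTower k R1 M1]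
  [AddCommGroup M2] [Module k M2] [Module R2 M2] [IsScalarTower k R2 M2]

/-- The action of `R2` on `M1 ⊗[k] M2` through the right factor, as an algebra morphism
to endomorphisms. -/
noncomputable def rightSMul : R2 →ₐ[k] Module.End k (M1 ⊗[k] M2) :=
  ((Module.endTensorEndAlgHom (R := k) (S := k) (A := k) (M := M1) (N := M2)).comp
      (Algebra.TensorProduct.includeRight (R := k) (A := Module.End k M1))).comp
    (Algebra.lsmul k k M2 (A := R2))

/-- The `R2`-module structure on `M1 ⊗[k] M2` via the right factor. -/
noncomputable def rightModule : Module R2 (M1 ⊗[k] M2) :=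
  Module.compHom _ (rightSMul k R2 M1 M2).toRingHom

/-- The `R1 ⊗[k] R2`-module structure on `M1 ⊗[k] M2`, characterized by
`(r1 ⊗ r2) • (m1 ⊗ m2) = (r1 • m1) ⊗ (r2 • m2)`; see `tensorModule_smul_tmul`. -/
noncomputable instance (priority := 10) tensorModule :
    Module (R1 ⊗[k] R2) (M1 ⊗[k] M2) :=
  letI m2 : Module R2 (M1 ⊗[k] M2) := rightModule k R2 M1 M2
  haveI t2 : IsScalarTower k R2 (M1 ⊗[k] M2) := by
    refine IsScalarTower.of_algebraMap_smul (fun r x => ?_)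
    show (rightSMul k R2 M1 M2) (algebraMap k R2 r) x = r • x
    rw [AlgHom.commutes]
    simp [Module.algebraMap_end_apply]
  haveI sc : SMulCommClass R1 R2 (M1 ⊗[k] M2) := by
    constructor
    intro r1 r2 x
    show r1 • (rightSMul k R2 M1 M2 r2) x = (rightSMul k R2 M1 M2 r2) (r1 • x)
    induction x using TensorProduct.induction_on with
    | zero => simp
    | tmul m n =>
        have h1 : (rightSMul k R2 M1 M2 r2) (m ⊗ₜ[k] n) = m ⊗ₜ[k] (r2 • n) := rfl
        have h2 : (rightSMul k R2 M1 M2 r2) ((r1 • m) ⊗ₜ[k] n) = (r1 • m) ⊗ₜ[k] (r2 • n) := rfl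
        rw [h1, smul_tmul', smul_tmul', h2]
    | add x y hx hy =>
        calc r1 • (rightSMul k R2 M1 M2 r2) (x + y)
            = r1 • ((rightSMul k R2 M1 M2 r2) x + (rightSMul k R2 M1 M2 r2) y) := by
              rw [(rightSMul k R2 M1 M2 r2).map_add]
          _ = r1 • (rightSMul k R2 M1 M2 r2) x + r1 • (rightSMul k R2 M1 M2 r2) y :=
              smul_add _ _ _
          _ = (rightSMul k R2 M1 M2 r2) (r1 • x) + (rightSMul k R2 M1 M2 r2) (r1 • y) := by
              rw [hx, hy]
          _ = (rightSMul k R2 M1 M2 r2) (r1 • x + r1 • y) :=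
              ((rightSMul k R2 M1 M2 r2).map_add _ _).symm
          _ = (rightSMul k R2 M1 M2 r2) (r1 • (x + y)) := by rw [smul_add]
  TensorProduct.Algebra.module

/-- The defining property of the `R1 ⊗[k] R2`-module structure on `M1 ⊗[k] M2`. -/
lemma tensorModule_smul_tmul (r1 : R1) (r2 : R2) (m : M1) (n : M2) :
    (r1 ⊗ₜ[k] r2 : R1 ⊗[k] R2) • (m ⊗ₜ[k] n : M1 ⊗[k] M2) = (r1 • m) ⊗ₜ[k] (r2 • n) := rfl

end TensorModule

section HomAlg

variable (R : Type) [CommRing R]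

/-- The `i`-th Ext group `Ext_R^i(M, N)`. -/
noncomputable def extGroup (M N : Type) [AddCommGroup M] [Module R M]
    [AddCommGroup N] [Module R N] (i : ℕ) : Type :=
  (((Ext R (ModuleCat R) i).obj (Opposite.op (ModuleCat.of R M))).obj (ModuleCat.of R N) :
    ModuleCat R)

/-- The `i`-th Tor group `Tor_i^R(M, N)`. -/
noncomputable def torGroup (M N : Type) [AddCommGroup M] [Module R M]
    [AddCommGroup N] [Module R N] (i : ℕ) : Type :=
  (((Tor (ModuleCat R) i).obj (ModuleCat.of R M)).obj (ModuleCat.of R N) : ModuleCat R)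

/-- `C` is a semidualizing `R`-module: it is finitely generated, the homothety map
`R → Hom_R(C,C)`, `r ↦ (x ↦ r • x)`, is bijective, and `Ext_R^i(C,C) = 0` for all `i > 0`. -/
noncomputable def IsSemidualizing (C : Type) [AddCommGroup C] [Module R C] : Prop :=
  Module.Finite R C ∧
  Function.Bijective (LinearMap.lsmul R C) ∧
  ∀ i : ℕ, 0 < i → Subsingleton (extGroup R C C i)

end HomAlg

section ExtVanishing

variable {R : Type} [CommRing R]

lemma subsingleton_extGroup_iff {M N : Type} [AddCommGroup M] [Module R M] [AddCommGroup N]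
    [Module R N] (n : ℕ) :
    Subsingleton (extGroup R M N (n + 1)) ↔
      Subsingleton (Abelian.Ext (ModuleCat.of R M) (ModuleCat.of R N) (n + 1)) := by
  let P := projectiveResolution (ModuleCat.of R M)
  have key : Subsingleton (extGroup R M N (n + 1)) ↔
      ∀ f : P.complex.X (n + 1) ⟶ ModuleCat.of R N, P.complex.d (n + 2) (n + 1) ≫ f = 0 →
        ∃ g : P.complex.X n ⟶ ModuleCat.of R N, P.complex.d (n + 1) n ≫ g = f := by
    unfold extGroup
    rw [← ModuleCat.isZero_iff_subsingleton, (P.isoExt (n + 1) _).isZero_iff,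
      ← HomologicalComplex.exactAt_iff_isZero_homology,
      HomologicalComplex.exactAt_iff' _ n (n + 1) (n + 2) (by simp) (by simp),
      ShortComplex.moduleCat_exact_iff]
    exact Iff.rfl
  rw [key]
  constructor
  · intro h
    refine subsingleton_of_forall_eq 0 fun x => ?_
    obtain ⟨f, hf, rfl⟩ := P.extMk_surjective x (n + 2) rfl
    exact (P.extMk_eq_zero_iff f _ rfl hf n rfl).2 (h f hf)
  · intro h f hf
    exact (P.extMk_eq_zero_iff f _ rfl hf n rfl).1 (Subsingleton.elim _ _)

lemma subsingleton_ext_of_projective (P N : Type) [AddCommGroup P] [Module R P]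
    [AddCommGroup N] [Module R N] [Module.Projective R P] (n : ℕ) :
    Subsingleton (Abelian.Ext (ModuleCat.of R P) (ModuleCat.of R N) (n + 1)) :=
  haveI : Projective (ModuleCat.of R P) := (IsProjective.iff_projective P).1 inferInstance
  Abelian.Ext.subsingleton_of_projective _ _ n

variable {A B C N : Type} [AddCommGroup A] [Module R A] [AddCommGroup B] [Module R B]
  [AddCommGroup C] [Module R C] [AddCommGroup N] [Module R N]
  {f : A →ₗ[R] B} {g : B →ₗ[R] C}

lemma shortExact_ofHom (hf : Function.Injective f) (hfg : Function.Exact f g)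
    (hg : Function.Surjective g) :
    (ShortComplex.mk (ModuleCat.ofHom f) (ModuleCat.ofHom g)
      (by ext x; exact hfg.apply_apply_eq_zero x)).ShortExact where
  exact := (ShortComplex.ShortExact.moduleCat_exact_iff_function_exact _).2 hfg
  mono_f := (ModuleCat.mono_iff_injective _).2 hf
  epi_g := (ModuleCat.epi_iff_surjective _).2 hg

lemma subsingleton_ext_quotient (hf : Function.Injective f) (hfg : Function.Exact f g)
    (hg : Function.Surjective g) {n : ℕ}
    (hA : Subsingleton (Abelian.Ext (ModuleCat.of R A) (ModuleCat.of R N) n))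
    (hB : Subsingleton (Abelian.Ext (ModuleCat.of R B) (ModuleCat.of R N) (n + 1))) :
    Subsingleton (Abelian.Ext (ModuleCat.of R C) (ModuleCat.of R N) (n + 1)) := by
  refine subsingleton_of_forall_eq 0 fun x => ?_
  obtain ⟨y, rfl⟩ := Abelian.Ext.contravariant_sequence_exact₃ (shortExact_ofHom hf hfg hg) _ x
    (hB.elim _ _) (add_comm 1 n)
  rw [hA.elim y 0, Abelian.Ext.comp_zero]

lemma subsingleton_ext_sub (hf : Function.Injective f) (hfg : Function.Exact f g)
    (hg : Function.Surjective g) {n : ℕ}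
    (hB : Subsingleton (Abelian.Ext (ModuleCat.of R B) (ModuleCat.of R N) n))
    (hC : Subsingleton (Abelian.Ext (ModuleCat.of R C) (ModuleCat.of R N) (n + 1))) :
    Subsingleton (Abelian.Ext (ModuleCat.of R A) (ModuleCat.of R N) n) := by
  refine subsingleton_of_forall_eq 0 fun x => ?_
  obtain ⟨y, rfl⟩ := Abelian.Ext.contravariant_sequence_exact₁ (shortExact_ofHom hf hfg hg) _ x
    (add_comm 1 n) (hC.elim _ _)
  rw [hB.elim y 0, Abelian.Ext.comp_zero]

lemma exists_extension_of_subsingleton_ext_one (hf : Function.Injective f)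
    (hfg : Function.Exact f g) (hg : Function.Surjective g)
    (hC : Subsingleton (Abelian.Ext (ModuleCat.of R C) (ModuleCat.of R N) 1))
    (h : A →ₗ[R] N) : ∃ h' : B →ₗ[R] N, h' ∘ₗ f = h := by
  obtain ⟨y, hy⟩ := Abelian.Ext.contravariant_sequence_exact₁ (shortExact_ofHom hf hfg hg) _
    (Abelian.Ext.mk₀ (ModuleCat.ofHom h)) (add_comm 1 0) (hC.elim _ _)
  obtain ⟨h', rfl⟩ := (Abelian.Ext.mk₀_bijective _ _).2 y
  rw [Abelian.Ext.mk₀_comp_mk₀] at hy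
  exact ⟨h'.hom, congr_arg ModuleCat.Hom.hom ((Abelian.Ext.mk₀_bijective _ _).1 hy)⟩

lemma subsingleton_ext_one_of_exists_extension (hf : Function.Injective f)
    (hfg : Function.Exact f g) (hg : Function.Surjective g)
    (H : ∀ h : A →ₗ[R] N, ∃ h' : B →ₗ[R] N, h' ∘ₗ f = h)
    (hB : Subsingleton (Abelian.Ext (ModuleCat.of R B) (ModuleCat.of R N) 1)) :
    Subsingleton (Abelian.Ext (ModuleCat.of R C) (ModuleCat.of R N) 1) := by
  have hS := shortExact_ofHom hf hfg hg
  refine subsingleton_of_forall_eq 0 fun x => ?_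
  obtain ⟨y, rfl⟩ := Abelian.Ext.contravariant_sequence_exact₃ hS _ x (hB.elim _ _) (add_comm 1 0)
  obtain ⟨h, rfl⟩ := (Abelian.Ext.mk₀_bijective _ _).2 y
  obtain ⟨h', hh⟩ := H h.hom
  have : h = ModuleCat.ofHom f ≫ ModuleCat.ofHom h' := by
    ext x
    exact (LinearMap.congr_fun hh x).symm
  rw [this, ← Abelian.Ext.mk₀_comp_mk₀, ← Abelian.Ext.comp_assoc_of_second_deg_zero,
    hS.extClass_comp, Abelian.Ext.zero_comp]

lemma subsingleton_ext_congr {X X' Y Y' : ModuleCat.{0} R} (e : X ≅ X') (e' : Y ≅ Y') {n : ℕ}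
    (h : Subsingleton (Abelian.Ext X Y n)) : Subsingleton (Abelian.Ext X' Y' n) := by
  refine subsingleton_of_forall_eq 0 fun x => ?_
  have hx : (Abelian.Ext.mk₀ e.inv).comp ((Abelian.Ext.mk₀ e.hom).comp
      (x.comp (Abelian.Ext.mk₀ e'.inv) (add_zero n)) (zero_add n)) (zero_add n) =
      x.comp (Abelian.Ext.mk₀ e'.inv) (add_zero n) := by
    simp
  have hx' : (x.comp (Abelian.Ext.mk₀ e'.inv) (add_zero n)).comp
      (Abelian.Ext.mk₀ e'.hom) (add_zero n) = x := by
    simp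
  rw [← hx', ← hx, h.elim ((Abelian.Ext.mk₀ e.hom).comp _ _) 0, Abelian.Ext.comp_zero,
    Abelian.Ext.zero_comp]

lemma subsingleton_ext_of_ringEquiv {R' : Type} [CommRing R'] (e : R ≃+* R')
    {M N M' N' : Type} [AddCommGroup M] [Module R M] [AddCommGroup N] [Module R N]
    [AddCommGroup M'] [Module R' M'] [AddCommGroup N'] [Module R' N']
    (u : M ≃+ M') (hu : ∀ (r : R) m, u (r • m) = e r • u m)
    (v : N ≃+ N') (hv : ∀ (r : R) m, v (r • m) = e r • v m) {n : ℕ}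
    (h : Subsingleton (Abelian.Ext (ModuleCat.of R M) (ModuleCat.of R N) n)) :
    Subsingleton (Abelian.Ext (ModuleCat.of R' M') (ModuleCat.of R' N') n) := by
  let iso {M M' : Type} [AddCommGroup M] [Module R M] [AddCommGroup M'] [Module R' M']
      (u : M ≃+ M') (hu : ∀ (r : R) m, u (r • m) = e r • u m) :
      ModuleCat.of R M ≅ (ModuleCat.restrictScalars e.toRingHom).obj (ModuleCat.of R' M') :=
    letI : Module R M' := Module.compHom M' e.toRingHom
    LinearEquiv.toModuleIso { u with map_smul' := hu }
  have := subsingleton_ext_congr (iso u hu) (iso v hv) h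
  exact ((ModuleCat.restrictScalars e.toRingHom).mapExt_bijective_of_preservesProjectiveObjects
    (ModuleCat.of R' M') (ModuleCat.of R' N') n).1.subsingleton

end ExtVanishing

section OneSided

variable (k : Type) [Field k] {R : Type} [CommRing R] [Algebra k R]
  (M N V : Type) [AddCommGroup M] [Module k M] [Module R M] [IsScalarTower k R M]
  [AddCommGroup N] [Module k N] [Module R N] [IsScalarTower k R N]
  [AddCommGroup V] [Module k V]

/-- The canonical map `Hom_R(M, N) ⊗ V → Hom_k(M, N ⊗ V)`. -/
noncomputable def homTensorToHom : (M →ₗ[R] N) ⊗[k] V →ₗ[k] M →ₗ[k] N ⊗[k] V :=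
  TensorProduct.rTensorHomToHomRTensor (RingHom.id k) M N V ∘ₗ
    (LinearMap.restrictScalarsₗ k R M N k).rTensor V

variable {M N V}

@[simp]
lemma homTensorToHom_tmul (f : M →ₗ[R] N) (v : V) (m : M) :
    homTensorToHom k M N V (f ⊗ₜ v) m = f m ⊗ₜ v := rfl

lemma homTensorToHom_smul (t : (M →ₗ[R] N) ⊗[k] V) (r : R) (m : M) :
    homTensorToHom k M N V t (r • m) = r • homTensorToHom k M N V t m := by
  induction t using TensorProduct.induction_on with
  | zero => simp
  | tmul f v => simp [smul_tmul']
  | add x y hx hy => simp [hx, hy]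

lemma equivFinsuppOfBasisRight_homTensorToHom {ι : Type} [DecidableEq ι]
    (b : Module.Basis ι k V) (t : (M →ₗ[R] N) ⊗[k] V) (m : M) (i : ι) :
    equivFinsuppOfBasisRight b (homTensorToHom k M N V t m) i =
      equivFinsuppOfBasisRight b t i m := by
  induction t using TensorProduct.induction_on with
  | zero => simp
  | tmul f v => simp
  | add x y hx hy => simp [hx, hy]

lemma homTensorToHom_injective : Function.Injective (homTensorToHom (R := R) k M N V) := by
  classical
  let b := Module.Basis.ofVectorSpace k V
  refine (injective_iff_map_eq_zero _).2 fun t ht => ?_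
  apply (equivFinsuppOfBasisRight b).injective
  ext i m
  rw [← equivFinsuppOfBasisRight_homTensorToHom, ht]
  simp

lemma equivFinsuppOfBasisRight_smul {ι : Type} [DecidableEq ι]
    (b : Module.Basis ι k V) (r : R) (x : N ⊗[k] V) (i : ι) :
    equivFinsuppOfBasisRight b (r • x) i = r • equivFinsuppOfBasisRight b x i := by
  induction x using TensorProduct.induction_on with
  | zero => simp
  | tmul n v => simp only [smul_tmul', equivFinsuppOfBasisRight_apply_tmul_apply, smul_comm r]
  | add x y hx hy => simp [hx, hy]

lemma exists_homTensorToHom_eq [Module.Finite R M] (φ : M →ₗ[k] N ⊗[k] V)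
    (hφ : ∀ (r : R) m, φ (r • m) = r • φ m) : ∃ t, homTensorToHom (R := R) k M N V t = φ := by
  classical
  let b := Module.Basis.ofVectorSpace k V
  let c (i) : M →ₗ[R] N :=
    { toFun := fun m => equivFinsuppOfBasisRight b (φ m) i
      map_add' := by simp
      map_smul' := by simp [hφ, equivFinsuppOfBasisRight_smul] }
  obtain ⟨s, hs⟩ := Module.Finite.fg_top (R := R) (M := M)
  let T := s.biUnion fun m => (equivFinsuppOfBasisRight b (φ m)).support
  have hT (i) (hi : i ∉ T) : c i = 0 := by
    refine LinearMap.ext_on hs fun m hm => ?_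
    by_contra h
    exact hi (Finset.mem_biUnion.2 ⟨m, hm, Finsupp.mem_support_iff.2 h⟩)
  refine ⟨∑ i ∈ T, c i ⊗ₜ b i, ?_⟩
  ext m
  apply (equivFinsuppOfBasisRight b).injective
  ext i
  rw [equivFinsuppOfBasisRight_homTensorToHom]
  have : equivFinsuppOfBasisRight b (∑ i ∈ T, c i ⊗ₜ[k] b i) i = c i := by
    simp only [map_sum, Finsupp.finsetSum_apply, equivFinsuppOfBasisRight_apply_tmul_apply,
      Module.Basis.repr_self, Finsupp.single_apply, ite_smul, one_smul, zero_smul,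
      Finset.sum_ite_eq']
    split_ifs with h
    · rfl
    · exact (hT i h).symm
  rw [this]
  rfl

end OneSided

section TwoSided

variable (k : Type) [Field k] {R1 R2 : Type} [CommRing R1] [CommRing R2]
  [Algebra k R1] [Algebra k R2]
  {M1 M2 N1 N2 : Type} [AddCommGroup M1] [Module k M1] [Module R1 M1] [IsScalarTower k R1 M1]
  [AddCommGroup M2] [Module k M2] [Module R2 M2] [IsScalarTower k R2 M2]
  [AddCommGroup N1] [Module k N1] [Module R1 N1] [IsScalarTower k R1 N1]
  [AddCommGroup N2] [Module k N2] [Module R2 N2] [IsScalarTower k R2 N2]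

/-- A `k`-linear map out of `M1 ⊗ M2` compatible with the actions on pure tensors is
`R1 ⊗ R2`-linear. -/
noncomputable def LinearMap.ofTensorSMul {X : Type} [AddCommGroup X] [Module k X]
    [Module (R1 ⊗[k] R2) X]
    (φ : M1 ⊗[k] M2 →ₗ[k] X)
    (hφ : ∀ (r1 : R1) (r2 : R2) m1 m2,
      φ ((r1 • m1) ⊗ₜ (r2 • m2)) = (r1 ⊗ₜ[k] r2) • φ (m1 ⊗ₜ m2)) :
    M1 ⊗[k] M2 →ₗ[R1 ⊗[k] R2] X where
  toFun := φ
  map_add' := φ.map_add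
  map_smul' s x := by
    induction s using TensorProduct.induction_on with
    | zero => simp
    | add s t hs ht => simp only [add_smul, map_add, hs, ht, RingHom.id_apply]
    | tmul r1 r2 =>
      induction x using TensorProduct.induction_on with
      | zero => simp
      | add x y hx hy => simp only [smul_add, map_add, hx, hy]
      | tmul m1 m2 => exact hφ r1 r2 m1 m2

lemma algebraMap_tensor_smul (c : k) (x : M1 ⊗[k] M2) :
    (algebraMap k (R1 ⊗[k] R2) c) • x = c • x := by
  induction x using TensorProduct.induction_on with
  | zero => simp
  | add x y hx hy => simp only [smul_add, hx, hy]
  | tmul m1 m2 =>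
    rw [Algebra.TensorProduct.algebraMap_apply, tensorModule_smul_tmul, algebraMap_smul, one_smul,
      smul_tmul']

/-- An `R1 ⊗ R2`-linear map between tensor products, regarded as a `k`-linear map. -/
noncomputable def LinearMap.toBaseField (h : M1 ⊗[k] M2 →ₗ[R1 ⊗[k] R2] N1 ⊗[k] N2) :
    M1 ⊗[k] M2 →ₗ[k] N1 ⊗[k] N2 where
  toFun := h
  map_add' := h.map_add
  map_smul' c x := by
    rw [← algebraMap_tensor_smul (R1 := R1) (R2 := R2) k c x, h.map_smul, algebraMap_tensor_smul,
      RingHom.id_apply]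

/-- The tensor product of an `R1`-linear and an `R2`-linear map, as an `R1 ⊗ R2`-linear map. -/
noncomputable def tensorMap (f : M1 →ₗ[R1] N1) (g : M2 →ₗ[R2] N2) :
    M1 ⊗[k] M2 →ₗ[R1 ⊗[k] R2] N1 ⊗[k] N2 :=
  LinearMap.ofTensorSMul k (TensorProduct.map (f.restrictScalars k) (g.restrictScalars k))
    (fun r1 r2 m1 m2 => by simp [tensorModule_smul_tmul])

@[simp]
lemma tensorMap_tmul (f : M1 →ₗ[R1] N1) (g : M2 →ₗ[R2] N2) (m1 : M1) (m2 : M2) :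
    tensorMap k f g (m1 ⊗ₜ m2) = f m1 ⊗ₜ g m2 := rfl

variable (R1 R2 M1 M2 N1 N2) in
/-- The canonical map `Hom_{R1}(M1, N1) ⊗ Hom_{R2}(M2, N2) → Hom_k(M1 ⊗ M2, N1 ⊗ N2)`. -/
noncomputable def homTensorHom :
    (M1 →ₗ[R1] N1) ⊗[k] (M2 →ₗ[R2] N2) →ₗ[k] M1 ⊗[k] M2 →ₗ[k] N1 ⊗[k] N2 :=
  TensorProduct.homTensorHomMap (RingHom.id k) M1 M2 N1 N2 ∘ₗ
    TensorProduct.map (LinearMap.restrictScalarsₗ k R1 M1 N1 k)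
      (LinearMap.restrictScalarsₗ k R2 M2 N2 k)

@[simp]
lemma homTensorHom_tmul (f : M1 →ₗ[R1] N1) (g : M2 →ₗ[R2] N2) (m1 : M1) (m2 : M2) :
    homTensorHom k R1 R2 M1 M2 N1 N2 (f ⊗ₜ g) (m1 ⊗ₜ m2) = f m1 ⊗ₜ g m2 := rfl

lemma homTensorHom_smul_tmul (t : (M1 →ₗ[R1] N1) ⊗[k] (M2 →ₗ[R2] N2)) (r1 : R1) (r2 : R2)
    (m1 : M1) (m2 : M2) :
    homTensorHom k R1 R2 M1 M2 N1 N2 t ((r1 • m1) ⊗ₜ (r2 • m2)) =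
      (r1 ⊗ₜ[k] r2) • homTensorHom k R1 R2 M1 M2 N1 N2 t (m1 ⊗ₜ m2) := by
  induction t using TensorProduct.induction_on with
  | zero => simp
  | add x y hx hy => simp only [map_add, LinearMap.add_apply, hx, hy, smul_add]
  | tmul f g => simp [tensorModule_smul_tmul]

lemma homTensorHom_eq_homTensorToHom (t : (M1 →ₗ[R1] N1) ⊗[k] (M2 →ₗ[R2] N2)) (m1 : M1)
    (m2 : M2) :
    homTensorHom k R1 R2 M1 M2 N1 N2 t (m1 ⊗ₜ m2) = TensorProduct.comm k N2 N1
      (homTensorToHom k M2 N2 N1 (TensorProduct.comm k N1 (M2 →ₗ[R2] N2)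
        (homTensorToHom k M1 N1 (M2 →ₗ[R2] N2) t m1)) m2) := by
  induction t using TensorProduct.induction_on with
  | zero => simp
  | add x y hx hy => simp only [map_add, LinearMap.add_apply, hx, hy]
  | tmul f g => simp

lemma homTensorHom_injective : Function.Injective (homTensorHom k R1 R2 M1 M2 N1 N2) := by
  refine (injective_iff_map_eq_zero _).2 fun t ht => ?_
  apply homTensorToHom_injective
  rw [map_zero]
  ext m1
  apply (TensorProduct.comm k N1 (M2 →ₗ[R2] N2)).injective
  apply homTensorToHom_injective
  ext m2
  apply (TensorProduct.comm k N2 N1).injective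
  rw [← homTensorHom_eq_homTensorToHom, ht]
  simp

lemma comm_homTensorToHom_smul (u : N1 ⊗[k] (M2 →ₗ[R2] N2)) (r : R1) (m : M2) :
    TensorProduct.comm k N2 N1 (homTensorToHom k M2 N2 N1 (TensorProduct.comm k _ _ (r • u)) m) =
      r • TensorProduct.comm k N2 N1
        (homTensorToHom k M2 N2 N1 (TensorProduct.comm k _ _ u) m) := by
  induction u using TensorProduct.induction_on with
  | zero => simp
  | add x y hx hy => simp only [map_add, LinearMap.add_apply, hx, hy, smul_add]
  | tmul n g => simp [smul_tmul']

lemma one_tmul_smul_comm (r : R2) (x : N2 ⊗[k] N1) :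
    ((1 : R1) ⊗ₜ[k] r) • TensorProduct.comm k N2 N1 x = TensorProduct.comm k N2 N1 (r • x) := by
  induction x using TensorProduct.induction_on with
  | zero => simp
  | add x y hx hy => simp only [map_add, hx, hy, smul_add]
  | tmul n g => simp [smul_tmul', tensorModule_smul_tmul]

lemma tmul_one_smul (r : R1) (x : N1 ⊗[k] N2) : (r ⊗ₜ[k] (1 : R2)) • x = r • x := by
  induction x using TensorProduct.induction_on with
  | zero => simp
  | add x y hx hy => simp only [hx, hy, smul_add]
  | tmul n g => simp [smul_tmul', tensorModule_smul_tmul]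

lemma exists_homTensorHom_eq [Module.Finite R1 M1] [Module.Finite R2 M2]
    (φ : M1 ⊗[k] M2 →ₗ[R1 ⊗[k] R2] N1 ⊗[k] N2) :
    ∃ t, ∀ x, homTensorHom k R1 R2 M1 M2 N1 N2 t x = φ x := by
  let φ' := LinearMap.toBaseField k φ
  let c := TensorProduct.comm k N1 N2
  let ψ : M1 →ₗ[k] M2 →ₗ[k] N2 ⊗[k] N1 :=
    (LinearMap.compRight k c.toLinearMap) ∘ₗ TensorProduct.curry φ'
  have hψ (m1 m2) : ψ m1 m2 = c (φ (m1 ⊗ₜ m2)) := rfl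
  have hrange (m1 : M1) : ψ m1 ∈ LinearMap.range (homTensorToHom (R := R2) k M2 N2 N1) := by
    refine exists_homTensorToHom_eq k (ψ m1) fun r m => ?_
    apply c.symm.injective
    simp only [hψ, c, TensorProduct.comm_symm]
    rw [← one_tmul_smul_comm (R1 := R1) k, ← TensorProduct.comm_symm,
      LinearEquiv.symm_apply_apply, LinearEquiv.symm_apply_apply, ← φ.map_smul,
      tensorModule_smul_tmul, one_smul]
  let e := LinearEquiv.ofInjective (homTensorToHom (R := R2) k M2 N2 N1)
    (homTensorToHom_injective k)
  let χ : M1 →ₗ[k] N1 ⊗[k] (M2 →ₗ[R2] N2) :=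
    (TensorProduct.comm k _ _).toLinearMap ∘ₗ e.symm.toLinearMap ∘ₗ ψ.codRestrict _ hrange
  have hχ (m1 m2) : TensorProduct.comm k N2 N1
      (homTensorToHom k M2 N2 N1 (TensorProduct.comm k _ _ (χ m1)) m2) = φ (m1 ⊗ₜ m2) := by
    have : homTensorToHom k M2 N2 N1 (TensorProduct.comm k _ _ (χ m1)) = ψ m1 := by
      simp only [χ, LinearMap.comp_apply, LinearEquiv.coe_coe]
      rw [← TensorProduct.comm_symm, LinearEquiv.symm_apply_apply]
      exact congr_arg Subtype.val (e.apply_symm_apply ⟨ψ m1, hrange m1⟩)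
    rw [this, hψ]
    exact c.symm_apply_apply _
  obtain ⟨t, ht⟩ := exists_homTensorToHom_eq (R := R1) k χ fun r m1 => by
    apply (TensorProduct.comm k N1 (M2 →ₗ[R2] N2)).injective
    apply homTensorToHom_injective
    ext m2
    apply (TensorProduct.comm k N2 N1).injective
    rw [comm_homTensorToHom_smul, hχ, hχ, ← tmul_one_smul (R2 := R2) k, ← φ.map_smul,
      tensorModule_smul_tmul, one_smul]
  refine ⟨t, fun x => ?_⟩
  induction x using TensorProduct.induction_on with
  | zero => simp
  | add x y hx hy => rw [map_add, hx, hy, map_add]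
  | tmul m1 m2 => rw [homTensorHom_eq_homTensorToHom, ht, hχ]

end TwoSided

section Lifting

variable (k : Type) [Field k] {R1 R2 : Type} [CommRing R1] [CommRing R2]
  [Algebra k R1] [Algebra k R2]
  {A1 A2 B1 B2 N1 N2 : Type} [AddCommGroup A1] [Module k A1] [Module R1 A1] [IsScalarTower k R1 A1]
  [AddCommGroup A2] [Module k A2] [Module R2 A2] [IsScalarTower k R2 A2]
  [AddCommGroup B1] [Module k B1] [Module R1 B1] [IsScalarTower k R1 B1]
  [AddCommGroup B2] [Module k B2] [Module R2 B2] [IsScalarTower k R2 B2]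
  [AddCommGroup N1] [Module k N1] [Module R1 N1] [IsScalarTower k R1 N1]
  [AddCommGroup N2] [Module k N2] [Module R2 N2] [IsScalarTower k R2 N2]
  (f : A1 →ₗ[R1] B1) (g : A2 →ₗ[R2] B2)

lemma homTensorHom_map_lcomp (t : (B1 →ₗ[R1] N1) ⊗[k] (B2 →ₗ[R2] N2)) (x : A1 ⊗[k] A2) :
    homTensorHom k R1 R2 A1 A2 N1 N2
      (TensorProduct.map (LinearMap.lcomp k N1 f) (LinearMap.lcomp k N2 g) t) x =
      homTensorHom k R1 R2 B1 B2 N1 N2 t (tensorMap k f g x) := by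
  induction t using TensorProduct.induction_on with
  | zero => simp
  | add s t hs ht => simp only [map_add, LinearMap.add_apply, hs, ht]
  | tmul u v =>
    induction x using TensorProduct.induction_on with
    | zero => simp
    | add x y hx hy => simp only [map_add, hx, hy]
    | tmul a b => simp

variable {f g}

lemma exists_extension_tensorMap [Module.Finite R1 A1] [Module.Finite R2 A2]
    (hf : ∀ h : A1 →ₗ[R1] N1, ∃ h' : B1 →ₗ[R1] N1, h' ∘ₗ f = h)
    (hg : ∀ h : A2 →ₗ[R2] N2, ∃ h' : B2 →ₗ[R2] N2, h' ∘ₗ g = h)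
    (h : A1 ⊗[k] A2 →ₗ[R1 ⊗[k] R2] N1 ⊗[k] N2) :
    ∃ h' : B1 ⊗[k] B2 →ₗ[R1 ⊗[k] R2] N1 ⊗[k] N2, h' ∘ₗ tensorMap k f g = h := by
  obtain ⟨t, ht⟩ := exists_homTensorHom_eq k h
  obtain ⟨t', rfl⟩ := TensorProduct.map_surjective
    (g := LinearMap.lcomp k N1 f) (g' := LinearMap.lcomp k N2 g) hf hg t
  refine ⟨LinearMap.ofTensorSMul k _ (homTensorHom_smul_tmul k t'), LinearMap.ext fun x => ?_⟩
  rw [← ht, homTensorHom_map_lcomp]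
  rfl

lemma exists_extension_of_tensorMap_id [Module.Finite R1 B1] [Module.Finite R2 A2]
    [Nontrivial (A2 →ₗ[R2] N2)]
    (H : ∀ h : A1 ⊗[k] A2 →ₗ[R1 ⊗[k] R2] N1 ⊗[k] N2,
      ∃ h' : B1 ⊗[k] A2 →ₗ[R1 ⊗[k] R2] N1 ⊗[k] N2, h' ∘ₗ tensorMap k f LinearMap.id = h)
    (h : A1 →ₗ[R1] N1) : ∃ h' : B1 →ₗ[R1] N1, h' ∘ₗ f = h := by
  have hs : Function.Surjective
      ((LinearMap.lcomp k N1 f).rTensor (A2 →ₗ[R2] N2)) := by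
    intro t
    obtain ⟨h', hh'⟩ := H (LinearMap.ofTensorSMul k _ (homTensorHom_smul_tmul k t))
    obtain ⟨t', ht'⟩ := exists_homTensorHom_eq k h'
    refine ⟨t', homTensorHom_injective k (LinearMap.ext fun x => ?_)⟩
    have h1 : (LinearMap.lcomp k N1 f).rTensor (A2 →ₗ[R2] N2) t' =
      TensorProduct.map (LinearMap.lcomp k N1 f)
        (LinearMap.lcomp k N2 (LinearMap.id : A2 →ₗ[R2] A2)) t' := rfl
    rw [h1, homTensorHom_map_lcomp, ht']
    exact LinearMap.congr_fun hh' x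
  rw [← LinearMap.lTensor_surj_iff_rTensor_surj] at hs
  exact (Module.FaithfullyFlat.lTensor_surjective_iff_surjective k _ _).1 hs h

end Lifting

section Exactness

variable (k : Type) [Field k] {R1 R2 : Type} [CommRing R1] [CommRing R2]
  [Algebra k R1] [Algebra k R2]
  {A B C M : Type} [AddCommGroup A] [Module k A] [AddCommGroup B] [Module k B]
  [AddCommGroup C] [Module k C] [AddCommGroup M] [Module k M]

section Left

variable [Module R1 A] [IsScalarTower k R1 A] [Module R1 B] [IsScalarTower k R1 B]
  [Module R1 C] [IsScalarTower k R1 C] [Module R2 M] [IsScalarTower k R2 M]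
  {f : A →ₗ[R1] B} {g : B →ₗ[R1] C}

lemma tensorMap_id_right_injective (hf : Function.Injective f) :
    Function.Injective (tensorMap k f (LinearMap.id : M →ₗ[R2] M)) :=
  Module.Flat.rTensor_preserves_injective_linearMap (f.restrictScalars k) hf

lemma tensorMap_id_right_surjective (hg : Function.Surjective g) :
    Function.Surjective (tensorMap k g (LinearMap.id : M →ₗ[R2] M)) :=
  LinearMap.rTensor_surjective M (g := g.restrictScalars k) hg

lemma tensorMap_id_right_exact (hfg : Function.Exact f g) (hg : Function.Surjective g) :
    Function.Exact (tensorMap k f (LinearMap.id : M →ₗ[R2] M))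
      (tensorMap k g (LinearMap.id : M →ₗ[R2] M)) :=
  rTensor_exact M (f := f.restrictScalars k) (g := g.restrictScalars k) hfg hg

end Left

section Right

variable [Module R2 A] [IsScalarTower k R2 A] [Module R2 B] [IsScalarTower k R2 B]
  [Module R2 C] [IsScalarTower k R2 C] [Module R1 M] [IsScalarTower k R1 M]
  {f : A →ₗ[R2] B} {g : B →ₗ[R2] C}

lemma tensorMap_id_left_injective (hf : Function.Injective f) :
    Function.Injective (tensorMap k (LinearMap.id : M →ₗ[R1] M) f) :=
  Module.Flat.lTensor_preserves_injective_linearMap (f.restrictScalars k) hf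

lemma tensorMap_id_left_surjective (hg : Function.Surjective g) :
    Function.Surjective (tensorMap k (LinearMap.id : M →ₗ[R1] M) g) :=
  LinearMap.lTensor_surjective M (g := g.restrictScalars k) hg

lemma tensorMap_id_left_exact (hfg : Function.Exact f g) (hg : Function.Surjective g) :
    Function.Exact (tensorMap k (LinearMap.id : M →ₗ[R1] M) f)
      (tensorMap k (LinearMap.id : M →ₗ[R1] M) g) :=
  lTensor_exact M (f := f.restrictScalars k) (g := g.restrictScalars k) hfg hg

end Right

end Exactness

section Free

variable (k : Type) [Field k] (R1 R2 : Type) [CommRing R1] [CommRing R2]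
  [Algebra k R1] [Algebra k R2] (m n : ℕ)

/-- The coordinates of an element of `R1 ^ m ⊗ R2 ^ n`. -/
noncomputable def tensorPiCoord :
    (Fin m → R1) ⊗[k] (Fin n → R2) →ₗ[R1 ⊗[k] R2] Fin m × Fin n → R1 ⊗[k] R2 :=
  LinearMap.pi fun p => LinearMap.ofTensorSMul k
    (TensorProduct.map (LinearMap.proj p.1) (LinearMap.proj p.2)) fun r1 r2 u v => by simp

/-- The element of `R1 ^ m ⊗ R2 ^ n` with given coordinates. -/
noncomputable def tensorPiOfCoord :
    (Fin m × Fin n → R1 ⊗[k] R2) →ₗ[R1 ⊗[k] R2] (Fin m → R1) ⊗[k] (Fin n → R2) :=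
  Fintype.linearCombination (R1 ⊗[k] R2)
    fun p : Fin m × Fin n => (Pi.single p.1 1 : Fin m → R1) ⊗ₜ[k] (Pi.single p.2 1 : Fin n → R2)

lemma tensorPiOfCoord_comp_tensorPiCoord :
    tensorPiOfCoord k R1 R2 m n ∘ₗ tensorPiCoord k R1 R2 m n = LinearMap.id := by
  ext x
  induction x using TensorProduct.induction_on with
  | zero => simp
  | add x y hx hy => rw [map_add, hx, hy, map_add]
  | tmul u v =>
    have h1 : ∑ i, u i • (Pi.single i 1 : Fin m → R1) = u := (pi_eq_sum_univ' u).symm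
    have h2 : ∑ i, v i • (Pi.single i 1 : Fin n → R2) = v := (pi_eq_sum_univ' v).symm
    conv_rhs => rw [LinearMap.id_apply, ← h1, ← h2, sum_tmul]
    simp only [LinearMap.comp_apply, tensorPiOfCoord, Fintype.linearCombination_apply,
      Fintype.sum_prod_type, tmul_sum]
    rfl

instance : Module.Projective (R1 ⊗[k] R2) ((Fin m → R1) ⊗[k] (Fin n → R2)) :=
  Module.Projective.of_split _ _ (tensorPiOfCoord_comp_tensorPiCoord k R1 R2 m n)

instance : Module.Finite (R1 ⊗[k] R2) ((Fin m → R1) ⊗[k] (Fin n → R2)) :=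
  Module.Finite.of_surjective (tensorPiOfCoord k R1 R2 m n) fun x =>
    ⟨_, LinearMap.congr_fun (tensorPiOfCoord_comp_tensorPiCoord k R1 R2 m n) x⟩

variable {k R1 R2} in
lemma Module.Finite.tensorModule (M1 M2 : Type) [AddCommGroup M1] [Module k M1] [Module R1 M1]
    [IsScalarTower k R1 M1] [AddCommGroup M2] [Module k M2] [Module R2 M2] [IsScalarTower k R2 M2]
    [Module.Finite R1 M1] [Module.Finite R2 M2] :
    Module.Finite (R1 ⊗[k] R2) (M1 ⊗[k] M2) := by
  obtain ⟨m, f, hf⟩ := Module.Finite.exists_fin' R1 M1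
  obtain ⟨n, g, hg⟩ := Module.Finite.exists_fin' R2 M2
  exact Module.Finite.of_surjective (tensorMap k f g)
    (TensorProduct.map_surjective (g := f.restrictScalars k) (g' := g.restrictScalars k) hf hg)

end Free

section ExtTensor

/-- The vanishing of `Ext_R^n(M, N)`. -/
abbrev ExtVanishes (R M N : Type) [CommRing R] [AddCommGroup M] [Module R M] [AddCommGroup N]
    [Module R N] (n : ℕ) : Prop :=
  Subsingleton (Abelian.Ext (ModuleCat.of R M) (ModuleCat.of R N) n)

variable (k : Type) [Field k] {R1 R2 : Type} [CommRing R1] [CommRing R2]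
  [Algebra k R1] [Algebra k R2]
  {M1 M2 N1 N2 : Type} [AddCommGroup M1] [Module k M1] [Module R1 M1] [IsScalarTower k R1 M1]
  [AddCommGroup M2] [Module k M2] [Module R2 M2] [IsScalarTower k R2 M2]
  [AddCommGroup N1] [Module k N1] [Module R1 N1] [IsScalarTower k R1 N1]
  [AddCommGroup N2] [Module k N2] [Module R2 N2] [IsScalarTower k R2 N2]

lemma extVanishes_free_tensor [IsNoetherianRing R2] (m n : ℕ) [Module.Finite R2 M2]
    (h : ExtVanishes R2 M2 N2 (n + 1)) :
    ExtVanishes (R1 ⊗[k] R2) ((Fin m → R1) ⊗[k] M2) (N1 ⊗[k] N2) (n + 1) := by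
  induction n generalizing M2 with
  | zero =>
    obtain ⟨q, g, hg⟩ := Module.Finite.exists_fin' R2 M2
    have hf := Subtype.val_injective (p := (· ∈ LinearMap.ker g))
    have hfg := LinearMap.exact_subtype_ker_map g
    refine subsingleton_ext_one_of_exists_extension (tensorMap_id_left_injective k hf)
      (tensorMap_id_left_exact k hfg hg) (tensorMap_id_left_surjective k hg)
      (exists_extension_tensorMap k (fun u => ⟨u, rfl⟩)
        (exists_extension_of_subsingleton_ext_one hf hfg hg h))
      (subsingleton_ext_of_projective _ _ _)
  | succ n ih =>
    obtain ⟨q, g, hg⟩ := Module.Finite.exists_fin' R2 M2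
    have hf := Subtype.val_injective (p := (· ∈ LinearMap.ker g))
    have hfg := LinearMap.exact_subtype_ker_map g
    exact subsingleton_ext_quotient (tensorMap_id_left_injective k hf)
      (tensorMap_id_left_exact k hfg hg) (tensorMap_id_left_surjective k hg)
      (ih (subsingleton_ext_sub hf hfg hg (subsingleton_ext_of_projective _ _ _) h))
      (subsingleton_ext_of_projective _ _ _)

lemma extVanishes_tensor [IsNoetherianRing R1] [IsNoetherianRing R2] (n : ℕ)
    [Module.Finite R1 M1] [Module.Finite R2 M2]
    (h2 : ∀ j ≤ n, ExtVanishes R2 M2 N2 (j + 1)) (h1 : ExtVanishes R1 M1 N1 (n + 1)) :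
    ExtVanishes (R1 ⊗[k] R2) (M1 ⊗[k] M2) (N1 ⊗[k] N2) (n + 1) := by
  induction n generalizing M1 with
  | zero =>
    obtain ⟨q, g, hg⟩ := Module.Finite.exists_fin' R1 M1
    have hf := Subtype.val_injective (p := (· ∈ LinearMap.ker g))
    have hfg := LinearMap.exact_subtype_ker_map g
    exact subsingleton_ext_one_of_exists_extension (tensorMap_id_right_injective k hf)
      (tensorMap_id_right_exact k hfg hg) (tensorMap_id_right_surjective k hg)
      (exists_extension_tensorMap k
        (exists_extension_of_subsingleton_ext_one hf hfg hg h1) (fun u => ⟨u, rfl⟩))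
      (extVanishes_free_tensor k _ _ (h2 0 le_rfl))
  | succ n ih =>
    obtain ⟨q, g, hg⟩ := Module.Finite.exists_fin' R1 M1
    have hf := Subtype.val_injective (p := (· ∈ LinearMap.ker g))
    have hfg := LinearMap.exact_subtype_ker_map g
    exact subsingleton_ext_quotient (tensorMap_id_right_injective k hf)
      (tensorMap_id_right_exact k hfg hg) (tensorMap_id_right_surjective k hg)
      (ih (fun j hj => h2 j (hj.trans n.le_succ))
        (subsingleton_ext_sub hf hfg hg (subsingleton_ext_of_projective _ _ _) h1))
      (extVanishes_free_tensor k _ _ (h2 _ le_rfl))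

lemma extVanishes_left_of_tensor [IsNoetherianRing R1] [IsNoetherianRing R2] (n : ℕ)
    [Module.Finite R1 M1] [Module.Finite R2 M2] [Nontrivial (M2 →ₗ[R2] N2)]
    (h2 : ∀ j < n, ExtVanishes R2 M2 N2 (j + 1))
    (h : ExtVanishes (R1 ⊗[k] R2) (M1 ⊗[k] M2) (N1 ⊗[k] N2) (n + 1)) :
    ExtVanishes R1 M1 N1 (n + 1) := by
  induction n generalizing M1 with
  | zero =>
    obtain ⟨q, g, hg⟩ := Module.Finite.exists_fin' R1 M1
    have hf := Subtype.val_injective (p := (· ∈ LinearMap.ker g))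
    have hfg := LinearMap.exact_subtype_ker_map g
    exact subsingleton_ext_one_of_exists_extension hf hfg hg
      (exists_extension_of_tensorMap_id k
        (exists_extension_of_subsingleton_ext_one (tensorMap_id_right_injective k hf)
          (tensorMap_id_right_exact k hfg hg) (tensorMap_id_right_surjective k hg) h))
      (subsingleton_ext_of_projective _ _ _)
  | succ n ih =>
    obtain ⟨q, g, hg⟩ := Module.Finite.exists_fin' R1 M1
    have hf := Subtype.val_injective (p := (· ∈ LinearMap.ker g))
    have hfg := LinearMap.exact_subtype_ker_map g
    exact subsingleton_ext_quotient hf hfg hg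
      (ih (fun j hj => h2 j (hj.trans n.lt_succ_self))
        (subsingleton_ext_sub (tensorMap_id_right_injective k hf)
          (tensorMap_id_right_exact k hfg hg) (tensorMap_id_right_surjective k hg)
          (extVanishes_free_tensor k _ _ (h2 n n.lt_succ_self)) h))
      (subsingleton_ext_of_projective _ _ _)

lemma tensorComm_smul (s : R1 ⊗[k] R2) (x : M1 ⊗[k] M2) :
    TensorProduct.comm k M1 M2 (s • x) =
      Algebra.TensorProduct.comm k R1 R2 s • TensorProduct.comm k M1 M2 x := by
  induction s using TensorProduct.induction_on with
  | zero => simp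
  | add s t hs ht => simp only [add_smul, map_add, hs, ht]
  | tmul r1 r2 =>
    induction x using TensorProduct.induction_on with
    | zero => simp
    | add x y hx hy => simp only [smul_add, map_add, hx, hy]
    | tmul m1 m2 => simp [tensorModule_smul_tmul]

lemma extVanishes_tensor_comm (n : ℕ)
    (h : ExtVanishes (R1 ⊗[k] R2) (M1 ⊗[k] M2) (N1 ⊗[k] N2) n) :
    ExtVanishes (R2 ⊗[k] R1) (M2 ⊗[k] M1) (N2 ⊗[k] N1) n :=
  subsingleton_ext_of_ringEquiv (Algebra.TensorProduct.comm k R1 R2).toRingEquiv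
    (TensorProduct.comm k M1 M2).toAddEquiv (tensorComm_smul k)
    (TensorProduct.comm k N1 N2).toAddEquiv (tensorComm_smul k) h

end ExtTensor

section Homothety

variable (k : Type) [Field k] {R1 R2 : Type} [CommRing R1] [CommRing R2]
  [Algebra k R1] [Algebra k R2]
  {C1 C2 : Type} [AddCommGroup C1] [Module k C1] [Module R1 C1] [IsScalarTower k R1 C1]
  [AddCommGroup C2] [Module k C2] [Module R2 C2] [IsScalarTower k R2 C2]

lemma homTensorHom_map_lsmul (s : R1 ⊗[k] R2) (x : C1 ⊗[k] C2) :
    homTensorHom k R1 R2 C1 C2 C1 C2 (TensorProduct.map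
      ((LinearMap.lsmul R1 C1).restrictScalars k) ((LinearMap.lsmul R2 C2).restrictScalars k) s) x =
        s • x := by
  induction s using TensorProduct.induction_on with
  | zero => simp
  | add s t hs ht => simp only [add_smul, map_add, LinearMap.add_apply, hs, ht]
  | tmul r1 r2 =>
    induction x using TensorProduct.induction_on with
    | zero => simp
    | add x y hx hy => simp only [smul_add, map_add, hx, hy]
    | tmul m1 m2 => simp [tensorModule_smul_tmul]

lemma bijective_lsmul_tensor_iff [Module.Finite R1 C1] [Module.Finite R2 C2] :
    Function.Bijective (LinearMap.lsmul (R1 ⊗[k] R2) (C1 ⊗[k] C2)) ↔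
      Function.Bijective (TensorProduct.map ((LinearMap.lsmul R1 C1).restrictScalars k)
        ((LinearMap.lsmul R2 C2).restrictScalars k)) := by
  let e : ((C1 →ₗ[R1] C1) ⊗[k] (C2 →ₗ[R2] C2)) ≃
      (C1 ⊗[k] C2 →ₗ[R1 ⊗[k] R2] C1 ⊗[k] C2) :=
    Equiv.ofBijective
      (fun t => LinearMap.ofTensorSMul k _ (homTensorHom_smul_tmul k t))
      ⟨fun t t' h => homTensorHom_injective k (LinearMap.ext fun x => LinearMap.congr_fun h x),
        fun φ => (exists_homTensorHom_eq k φ).imp fun t ht => LinearMap.ext ht⟩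
  rw [← e.comp_bijective]
  refine iff_of_eq (congr_arg _ (funext fun s => LinearMap.ext fun x => ?_))
  exact (homTensorHom_map_lsmul k s x).symm

end Homothety

section VectorSpaces

variable {k V W V' W' : Type} [Field k] [AddCommGroup V] [Module k V] [AddCommGroup W] [Module k W]
  [AddCommGroup V'] [Module k V'] [AddCommGroup W'] [Module k W']

lemma bijective_left_of_bijective_tensorMap [Nontrivial V'] [Nontrivial W'] {f : V →ₗ[k] W}
    {g : V' →ₗ[k] W'} (h : Function.Bijective (TensorProduct.map f g)) : Function.Bijective f := by
  constructor
  · have h1 : Function.Injective (f.rTensor V') := by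
      refine Function.Injective.of_comp (f := g.lTensor W) ?_
      rw [← LinearMap.coe_comp, LinearMap.lTensor_comp_rTensor]
      exact h.1
    rw [← LinearMap.lTensor_inj_iff_rTensor_inj] at h1
    exact (Module.FaithfullyFlat.lTensor_injective_iff_injective k _ _).1 h1
  · have h1 : Function.Surjective (f.rTensor W') := by
      refine Function.Surjective.of_comp (g := g.lTensor V) ?_
      rw [← LinearMap.coe_comp, LinearMap.rTensor_comp_lTensor]
      exact h.2
    rw [← LinearMap.lTensor_surj_iff_rTensor_surj] at h1
    exact (Module.FaithfullyFlat.lTensor_surjective_iff_surjective k _ _).1 h1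

lemma bijective_right_of_bijective_tensorMap [Nontrivial V] [Nontrivial W] {f : V →ₗ[k] W}
    {g : V' →ₗ[k] W'} (h : Function.Bijective (TensorProduct.map f g)) : Function.Bijective g := by
  refine bijective_left_of_bijective_tensorMap (f := g) (g := f) ?_
  have h1 : TensorProduct.map g f = (TensorProduct.comm k W W').toLinearMap ∘ₗ
      TensorProduct.map f g ∘ₗ (TensorProduct.comm k V' V).toLinearMap := by
    ext; rfl
  rw [h1]
  exact (TensorProduct.comm k W W').bijective.comp (h.comp (TensorProduct.comm k V' V).bijective)

end VectorSpaces

open TensorProduct in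
/-- Let `k` be a field and `R1`, `R2` nonzero commutative noetherian `k`-algebras,
`C1` a finitely generated `R1`-module and `C2` a finitely generated `R2`-module.
Then `C1 ⊗[k] C2` is semidualizing over `R1 ⊗[k] R2` iff `C1` is semidualizing over `R1`
and `C2` is semidualizing over `R2`. -/
theorem semidualizing_tensorProduct_iff
    (k : Type) [Field k] (R1 R2 : Type) [CommRing R1] [CommRing R2]
    [Algebra k R1] [Algebra k R2] [Nontrivial R1] [Nontrivial R2]
    [IsNoetherianRing R1] [IsNoetherianRing R2]
    (C1 C2 : Type) [AddCommGroup C1] [Module k C1] [Module R1 C1] [IsScalarTower k R1 C1]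
    [AddCommGroup C2] [Module k C2] [Module R2 C2] [IsScalarTower k R2 C2]
    [Module.Finite R1 C1] [Module.Finite R2 C2] :
    IsSemidualizing (R1 ⊗[k] R2) (C1 ⊗[k] C2) ↔
      IsSemidualizing R1 C1 ∧ IsSemidualizing R2 C2 := by
  constructor
  · rintro ⟨-, hχ, hE⟩
    have : Nontrivial (C1 ⊗[k] C2) := by
      by_contra h
      rw [not_nontrivial_iff_subsingleton] at h
      exact one_ne_zero (hχ.1 (LinearMap.ext fun x => Subsingleton.elim _ _) :
        (1 : R1 ⊗[k] R2) = 0)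
    have : Nontrivial C1 := by
      by_contra h
      rw [not_nontrivial_iff_subsingleton] at h
      exact not_subsingleton (C1 ⊗[k] C2) inferInstance
    have : Nontrivial C2 := by
      by_contra h
      rw [not_nontrivial_iff_subsingleton] at h
      exact not_subsingleton (C1 ⊗[k] C2) inferInstance
    rw [bijective_lsmul_tensor_iff] at hχ
    have hE' (n : ℕ) : ExtVanishes (R1 ⊗[k] R2) (C1 ⊗[k] C2) (C1 ⊗[k] C2) (n + 1) :=
      (subsingleton_extGroup_iff n).1 (hE _ n.succ_pos)
    have key (n : ℕ) : ExtVanishes R1 C1 C1 (n + 1) ∧ ExtVanishes R2 C2 C2 (n + 1) := by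
      induction n using Nat.strong_induction_on with
      | _ n ih =>
        exact ⟨extVanishes_left_of_tensor k n (fun j hj => (ih j hj).2) (hE' n),
          extVanishes_left_of_tensor k n (fun j hj => (ih j hj).1)
            (extVanishes_tensor_comm k _ (hE' n))⟩
    refine ⟨⟨inferInstance, bijective_left_of_bijective_tensorMap hχ, fun i hi => ?_⟩,
      inferInstance, bijective_right_of_bijective_tensorMap hχ, fun i hi => ?_⟩
    all_goals obtain ⟨n, rfl⟩ := Nat.exists_eq_succ_of_ne_zero hi.ne'
    · exact (subsingleton_extGroup_iff n).2 (key n).1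
    · exact (subsingleton_extGroup_iff n).2 (key n).2
  · rintro ⟨⟨-, hχ1, hE1⟩, -, hχ2, hE2⟩
    refine ⟨Module.Finite.tensorModule C1 C2, (bijective_lsmul_tensor_iff k).2 ?_,
      fun i hi => ?_⟩
    · exact TensorProduct.map_bijective (f := (LinearMap.lsmul R1 C1).restrictScalars k)
        (g := (LinearMap.lsmul R2 C2).restrictScalars k) hχ1 hχ2
    · obtain ⟨n, rfl⟩ := Nat.exists_eq_succ_of_ne_zero hi.ne'
      exact (subsingleton_extGroup_iff n).2 (extVanishes_tensor k n
        (fun j _ => (subsingleton_extGroup_iff j).1 (hE2 _ j.succ_pos))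
        ((subsingleton_extGroup_iff n).1 (hE1 _ n.succ_pos)))
end

section
/- Let k be a field and let R1 and R2 be commutative noetherian local k-algebras. Let C1, D1 be semidualizing R1-modules and C2, D2 be semidualizing R2-modules. If C1 ⊗_k C2 and D1 ⊗_k D2 are isomorphic as (R1 ⊗_k R2)-modules, then C1 ≅ D1 as R1-modules and C2 ≅ D2 as R2-modules. -/
open TensorProduct CategoryTheory

theorem tmul_one_smul_s1
    (k : Type) [CommRing k] (R1 R2 : Type) [CommRing R1] [CommRing R2]
    [Algebra k R1] [Algebra k R2]
    (M1 M2 : Type) [AddCommGroup M1] [Module k M1] [Module R1 M1] [IsScalarTower k R1 M1]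
    [AddCommGroup M2] [Module k M2] [Module R2 M2] [IsScalarTower k R2 M2]
    (r : R1) (x : M1 ⊗[k] M2) : (r ⊗ₜ[k] 1 : R1 ⊗[k] R2) • x = r • x := by
  induction x with
  | zero => simp
  | tmul m n => rw [tensorModule_smul_tmul, one_smul, smul_tmul']
  | add y z hy hz => rw [smul_add, smul_add, hy, hz]

theorem comm_one_tmul_smul
    (k : Type) [CommRing k] (R1 R2 : Type) [CommRing R1] [CommRing R2]
    [Algebra k R1] [Algebra k R2]
    (M1 M2 : Type) [AddCommGroup M1] [Module k M1] [Module R1 M1] [IsScalarTower k R1 M1]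
    [AddCommGroup M2] [Module k M2] [Module R2 M2] [IsScalarTower k R2 M2]
    (r : R2) (x : M1 ⊗[k] M2) :
    TensorProduct.comm k M1 M2 ((1 ⊗ₜ[k] r : R1 ⊗[k] R2) • x) =
      r • TensorProduct.comm k M1 M2 x := by
  induction x with
  | zero => simp
  | tmul m n => rw [tensorModule_smul_tmul, one_smul, comm_tmul, comm_tmul, smul_tmul']
  | add y z hy hz => rw [smul_add, map_add, map_add, smul_add, hy, hz]

/-- If the homotheties exhaust the endomorphisms of `N` over a local ring, then every
nonzero retract of `N` is all of `N`. -/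
theorem nonempty_linearEquiv_of_comp_eq_id {R M N : Type*} [CommRing R] [IsLocalRing R]
    [AddCommGroup M] [Module R M] [Nontrivial M] [AddCommGroup N] [Module R N]
    (hN : Function.Bijective (LinearMap.lsmul R N)) (a : M →ₗ[R] N) (b : N →ₗ[R] M)
    (hba : b ∘ₗ a = LinearMap.id) : Nonempty (M ≃ₗ[R] N) := by
  have hb (m : M) : b (a m) = m := LinearMap.congr_fun hba m
  obtain ⟨r, hr⟩ := hN.2 (a ∘ₗ b)
  have hab (n : N) : r • n = a (b n) := LinearMap.congr_fun hr n
  have hidem : r * r = r := by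
    apply hN.1
    ext n
    simp [mul_smul, hab, hb]
  have hmul : r * (1 - r) = 0 := by rw [mul_sub, mul_one, hidem, sub_self]
  rcases IsLocalRing.isUnit_or_isUnit_one_sub_self r with hu | hu
  · have h1 : r = 1 := (sub_eq_zero.mp (hu.mul_right_eq_zero.mp hmul)).symm
    refine ⟨LinearEquiv.ofLinearMap a b ?_ hba⟩
    ext n
    simp [← hab, h1]
  · have h0 : r = 0 := hu.mul_left_eq_zero.mp hmul
    obtain ⟨m, hm⟩ := exists_ne (0 : M)
    refine absurd ?_ hm
    rw [← hb m, ← hb m, ← hab, h0, zero_smul, map_zero]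

/-- Over a local ring, two nonzero modules whose endomorphisms are all homotheties are
isomorphic as soon as their scalar extensions by nonzero vector spaces are. -/
theorem nonempty_linearEquiv_of_tensorProduct {k R M N V W : Type*} [Field k] [CommRing R]
    [IsLocalRing R] [Algebra k R]
    [AddCommGroup M] [Module k M] [Module R M] [IsScalarTower k R M] [Nontrivial M]
    [AddCommGroup N] [Module k N] [Module R N] [IsScalarTower k R N]
    [AddCommGroup V] [Module k V] [Nontrivial V] [AddCommGroup W] [Module k W]
    (hM : Function.Bijective (LinearMap.lsmul R M))
    (hN : Function.Bijective (LinearMap.lsmul R N))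
    (e : (M ⊗[k] V) ≃ₗ[R] (N ⊗[k] W)) : Nonempty (M ≃ₗ[R] N) := by
  classical
  obtain ⟨v, hv⟩ := exists_ne (0 : V)
  obtain ⟨f, hf⟩ := Module.Projective.exists_dual_eq_one k hv
  let B := Module.Basis.ofVectorSpace k W
  let a (j) : M →ₗ[R] N :=
    (TensorProduct.AlgebraTensorModule.rid k R N).toLinearMap ∘ₗ
      TensorProduct.AlgebraTensorModule.map LinearMap.id (B.coord j) ∘ₗ e.toLinearMap ∘ₗ
        (TensorProduct.AlgebraTensorModule.mk k R M V).flip v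
  let b (j) : N →ₗ[R] M :=
    (TensorProduct.AlgebraTensorModule.rid k R M).toLinearMap ∘ₗ
      TensorProduct.AlgebraTensorModule.map LinearMap.id f ∘ₗ e.symm.toLinearMap ∘ₗ
        (TensorProduct.AlgebraTensorModule.mk k R N W).flip (B j)
  suffices h : ∃ j, ∃ u : R, IsUnit u ∧ ∀ m, b j (a j m) = u • m by
    obtain ⟨j, _, ⟨u, rfl⟩, hu⟩ := h
    refine nonempty_linearEquiv_of_comp_eq_id hN (a j) ((↑u⁻¹ : R) • b j) ?_
    ext m
    simp [hu, smul_smul]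
  choose r hr using fun j => hM.2 (b j ∘ₗ a j)
  have hba (j) (m : M) : b j (a j m) = r j • m := (LinearMap.congr_fun (hr j) m).symm
  by_contra! hne
  have hmem (j) : r j ∈ IsLocalRing.maximalIdeal R := by
    by_contra hj
    obtain ⟨m, hm⟩ := hne j (r j) (by simpa using hj)
    exact hm (hba j m)
  obtain ⟨m, hm⟩ := exists_ne (0 : M)
  let c := TensorProduct.equivFinsuppOfBasisRight B (e (m ⊗ₜ[k] v))
  have hc (j) : c j = a j m := TensorProduct.equivFinsuppOfBasisRight_apply B _ j
  have hsum : ∑ j ∈ c.support, c j ⊗ₜ[k] B j = e (m ⊗ₜ[k] v) := by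
    have := (TensorProduct.equivFinsuppOfBasisRight B).symm_apply_apply (e (m ⊗ₜ[k] v))
    rwa [TensorProduct.equivFinsuppOfBasisRight_symm_apply] at this
  have hm' : ∑ j ∈ c.support, b j (a j m) = m := by
    have := congrArg ((TensorProduct.AlgebraTensorModule.rid k R M).toLinearMap ∘ₗ
      TensorProduct.AlgebraTensorModule.map LinearMap.id f ∘ₗ e.symm.toLinearMap) hsum
    rw [map_sum] at this
    simpa [b, ← hc, hf] using this
  have hunit : IsUnit (1 - ∑ j ∈ c.support, r j) := by
    have := (IsLocalRing.maximalIdeal R).sum_mem (t := c.support) fun j _ => hmem j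
    exact (IsLocalRing.isUnit_or_isUnit_one_sub_self _).resolve_left
      ((IsLocalRing.mem_maximalIdeal _).mp this)
  refine hm (hunit.smul_eq_zero.mp ?_)
  rw [sub_smul, one_smul, Finset.sum_smul, sub_eq_zero]
  simpa [hba] using hm'.symm

theorem IsSemidualizing.nontrivial {R : Type} [CommRing R] [Nontrivial R] {C : Type}
    [AddCommGroup C] [Module R C] (hC : IsSemidualizing R C) : Nontrivial C := by
  by_contra h
  rw [not_nontrivial_iff_subsingleton] at h
  exact one_ne_zero (hC.2.1.1 (LinearMap.ext fun _ => Subsingleton.elim _ _) : (1 : R) = 0)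

open TensorProduct in
/-- Let `k` be a field, `R1`, `R2` commutative noetherian local `k`-algebras,
`C1, D1` semidualizing `R1`-modules and `C2, D2` semidualizing `R2`-modules.
If `C1 ⊗[k] C2 ≅ D1 ⊗[k] D2` as `R1 ⊗[k] R2`-modules, then `C1 ≅ D1` as `R1`-modules
and `C2 ≅ D2` as `R2`-modules. -/
theorem tensorProduct_semidualizing_injective
    (k : Type) [Field k] (R1 R2 : Type) [CommRing R1] [CommRing R2]
    [Algebra k R1] [Algebra k R2]
    [IsNoetherianRing R1] [IsNoetherianRing R2] [IsLocalRing R1] [IsLocalRing R2]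
    (C1 D1 : Type) [AddCommGroup C1] [Module k C1] [Module R1 C1] [IsScalarTower k R1 C1]
    [AddCommGroup D1] [Module k D1] [Module R1 D1] [IsScalarTower k R1 D1]
    (C2 D2 : Type) [AddCommGroup C2] [Module k C2] [Module R2 C2] [IsScalarTower k R2 C2]
    [AddCommGroup D2] [Module k D2] [Module R2 D2] [IsScalarTower k R2 D2]
    (hC1 : IsSemidualizing R1 C1) (hD1 : IsSemidualizing R1 D1)
    (hC2 : IsSemidualizing R2 C2) (hD2 : IsSemidualizing R2 D2)
    (h : Nonempty ((C1 ⊗[k] C2) ≃ₗ[R1 ⊗[k] R2] (D1 ⊗[k] D2))) :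
    Nonempty (C1 ≃ₗ[R1] D1) ∧ Nonempty (C2 ≃ₗ[R2] D2) := by
  obtain ⟨e⟩ := h
  have := hC1.nontrivial
  have := hC2.nontrivial
  let e1 : (C1 ⊗[k] C2) ≃ₗ[R1] (D1 ⊗[k] D2) :=
    { e with
      map_smul' := fun r x =>
        (congrArg e (tmul_one_smul_s1 k R1 R2 C1 C2 r x).symm).trans
          ((e.map_smul _ _).trans (tmul_one_smul_s1 k R1 R2 D1 D2 r _)) }
  let e2 : (C2 ⊗[k] C1) ≃ₗ[R2] (D2 ⊗[k] D1) :=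
    { (TensorProduct.comm k C1 C2).symm.toAddEquiv.trans
        (e.toAddEquiv.trans (TensorProduct.comm k D1 D2).toAddEquiv) with
      map_smul' := fun r x => by
        obtain ⟨y, rfl⟩ := (TensorProduct.comm k C1 C2).surjective x
        change TensorProduct.comm k D1 D2 (e ((TensorProduct.comm k C1 C2).symm _)) =
          r • TensorProduct.comm k D1 D2 (e ((TensorProduct.comm k C1 C2).symm _))
        rw [← comm_one_tmul_smul k R1 R2 C1 C2, LinearEquiv.symm_apply_apply,
          LinearEquiv.symm_apply_apply, e.map_smul, comm_one_tmul_smul] }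
  exact ⟨nonempty_linearEquiv_of_tensorProduct hC1.2.1 hD1.2.1 e1,
    nonempty_linearEquiv_of_tensorProduct hC2.2.1 hD2.2.1 e2⟩
end
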